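/- arXiv:1906.06926 — 2 statements merged into one kernel-verified Lean document; each statement's English description precedes it below -/
import Mathlib

section
/- Scalar convergence lemma underlying Theorem 1: let k₁ > 0 and let ξ : [0,∞) → [-1,1] be differentiable with ξ(0) > -1, satisfying ξ'(t) = k₁(1 - ξ(t)²) whenever 0 ≤ ξ(t) ≤ 1 and ξ'(t) = k₁ √(1 - ξ(t)²) whenever -1 < ξ(t) < 0. Then ξ is nondecreasing and lim_{t→∞} ξ(t) = 1. -/
open Filter

/-- scalar convergence lemma underlying Theorem 1: if
`ξ : [0,∞) → [-1,1]` is differentiable with `ξ(0) > -1`, and its derivative `D`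
satisfies `D(t) = k₁(1-ξ(t)²)` whenever `0 ≤ ξ(t) ≤ 1` and
`D(t) = k₁ √(1-ξ(t)²)` whenever `-1 < ξ(t) < 0`, then `ξ` is nondecreasing and
`ξ(t) → 1` as `t → ∞`. -/
theorem xi_convergence (k₁ : ℝ) (hk : 0 < k₁) (ξ D : ℝ → ℝ)
    (hrange : ∀ t ≥ (0 : ℝ), ξ t ∈ Set.Icc (-1 : ℝ) 1)
    (hder : ∀ t ≥ (0 : ℝ), HasDerivAt ξ (D t) t)
    (hD1 : ∀ t ≥ (0 : ℝ), 0 ≤ ξ t → ξ t ≤ 1 → D t = k₁ * (1 - ξ t ^ 2))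
    (hD2 : ∀ t ≥ (0 : ℝ), -1 < ξ t → ξ t < 0 → D t = k₁ * Real.sqrt (1 - ξ t ^ 2))
    (h0 : -1 < ξ 0) :
    MonotoneOn ξ (Set.Ici 0) ∧ Tendsto ξ atTop (nhds 1) := by
  have hcont : ContinuousOn ξ (Set.Ici 0) :=
    fun t ht => (hder t ht).continuousAt.continuousWithinAt
  have hdiff : DifferentiableOn ℝ ξ (interior (Set.Ici 0)) :=
    fun t ht => (hder t (interior_subset ht)).differentiableAt.differentiableWithinAt
  obtain ⟨c, hc1, hc0, hcξ⟩ : ∃ c : ℝ, -1 < c ∧ c < 0 ∧ c ≤ ξ 0 :=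
    ⟨min (ξ 0) (-1 / 2), lt_min h0 (by norm_num),
      (min_le_right _ _).trans_lt (by norm_num), min_le_left _ _⟩
  have hlow : ∀ t ≥ (0 : ℝ), c ≤ ξ t := by
    intro T hT
    have h := image_le_of_deriv_right_lt_deriv_boundary (f := fun t => -ξ t)
      (f' := fun t => -D t) (a := 0) (b := T) (B := fun _ => -c) (B' := fun _ => 0)
      (hcont.mono Set.Icc_subset_Ici_self).neg
      (fun t ht => (hder t ht.1).neg.hasDerivWithinAt)
      (neg_le_neg hcξ) (fun t => hasDerivAt_const t _)
      (fun t ht hξ => by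
        have hξ : ξ t = c := neg_injective hξ
        rw [hD2 t ht.1 (hξ ▸ hc1) (hξ ▸ hc0), hξ]
        exact neg_neg_of_pos (mul_pos hk (Real.sqrt_pos.2 (by nlinarith))))
    exact neg_le_neg_iff.1 (h (Set.right_mem_Icc.2 hT))
  have hDlow : ∀ t ≥ (0 : ℝ), k₁ * (1 - ξ t ^ 2) ≤ D t := by
    intro t ht
    have h1 := (hrange t ht).2
    have hc := hlow t ht
    rcases le_or_gt 0 (ξ t) with h | h
    · exact (hD1 t ht h h1).ge
    · rw [hD2 t ht (hc1.trans_le hc) h]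
      have hsq : 0 ≤ 1 - ξ t ^ 2 := by nlinarith
      exact mul_le_mul_of_nonneg_left
        (Real.le_sqrt_of_sq_le (by nlinarith [mul_nonneg (sq_nonneg (ξ t)) hsq])) hk.le
  have hmono : MonotoneOn ξ (Set.Ici 0) := by
    refine monotoneOn_of_deriv_nonneg (convex_Ici 0) hcont hdiff fun t ht => ?_
    have ht : 0 ≤ t := interior_subset ht
    have h := hrange t ht
    rw [(hder t ht).deriv]
    exact (mul_nonneg hk.le (by nlinarith [h.1, h.2])).trans (hDlow t ht)
  refine ⟨hmono, tendsto_order.2 ⟨fun a ha => ?_, fun a ha => ?_⟩⟩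
  · obtain ⟨T, hT, haT⟩ : ∃ T ≥ (0 : ℝ), a < ξ T := by
      by_contra! hle
      set δ := k₁ * ((1 - a) * (1 + c)) with hδ
      have hδpos : 0 < δ := mul_pos hk (mul_pos (by linarith) (by linarith))
      have hderiv : ∀ t ∈ interior (Set.Ici (0 : ℝ)), δ ≤ deriv ξ t := by
        intro t ht
        have ht : 0 ≤ t := interior_subset ht
        rw [(hder t ht).deriv]
        refine le_trans (mul_le_mul_of_nonneg_left ?_ hk.le) (hDlow t ht)
        calc (1 - a) * (1 + c) ≤ (1 - ξ t) * (1 + ξ t) :=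
              mul_le_mul (by linarith [hle t ht]) (by linarith [hlow t ht])
                (by linarith) (by linarith [(hrange t ht).2])
          _ = 1 - ξ t ^ 2 := by ring
      have hT : 0 ≤ 3 / δ := by positivity
      have h := (convex_Ici (0 : ℝ)).mul_sub_le_image_sub_of_le_deriv hcont hdiff hderiv
        0 Set.self_mem_Ici (3 / δ) hT hT
      rw [sub_zero, mul_div_cancel₀ _ hδpos.ne'] at h
      linarith [(hrange _ hT).2]
    filter_upwards [eventually_ge_atTop T] with t ht
    exact haT.trans_le (hmono hT (hT.trans ht) ht)
  · filter_upwards [eventually_ge_atTop 0] with t ht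
    exact (hrange t ht).2.trans_lt ha
end

section
/- Theorem 2 (tracking on S¹): let k₂ > 0 and let w = (w₁, w₂) : [0,∞) → S¹ be a differentiable solution of ẇ₁ = u_{w,FB}(w) w₂, ẇ₂ = -u_{w,FB}(w) w₁, where u_{w,FB}(w) := k₂ w₂ if w₁ ≥ 0, u_{w,FB}(w) := -k₂ if w₁ < 0 and w₂ < 0, and u_{w,FB}(w) := k₂ if w₁ < 0 and w₂ ≥ 0. Then for every initial condition w(0) ∈ S¹, lim_{t→∞} w₁(t) = 1 and lim_{t→∞} w₂(t) = 0. -/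
open Filter

/-- The `S¹` feedback law `u_{w,FB}`. -/
noncomputable def uwFB (k₂ w₁ w₂ : ℝ) : ℝ :=
  if 0 ≤ w₁ then k₂ * w₂
  else if w₂ < 0 then -k₂
  else k₂

/-- On the unit circle the feedback `uwFB` pushes `w₁` up at rate at least `k₂ * w₂ ^ 2`. -/
theorem mul_sq_le_uwFB_mul {k₂ x y : ℝ} (hk : 0 < k₂) (h : x ^ 2 + y ^ 2 = 1) :
    k₂ * y ^ 2 ≤ uwFB k₂ x y * y := by
  have hy : |y| ≤ 1 := abs_le_one_iff_mul_self_le_one.2 (by nlinarith [sq_nonneg x])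
  obtain ⟨hy₁, hy₂⟩ := abs_le.1 hy
  unfold uwFB
  split_ifs with hx hneg
  · exact le_of_eq (by ring)
  · have : 0 ≤ k₂ * (-y * (1 + y)) :=
      mul_nonneg hk.le (mul_nonneg (by linarith) (by linarith))
    nlinarith
  · have : 0 ≤ k₂ * (y * (1 - y)) :=
      mul_nonneg hk.le (mul_nonneg (by linarith) (by linarith))
    nlinarith

/-- A function with `c * (1 - f) ≤ f'` on `[t₀, ∞)`, `c > 0`, bounded above by `1` there,
tends to `1`. -/
theorem tendsto_one_of_mul_one_sub_le_deriv {f f' : ℝ → ℝ} {c t₀ : ℝ} (hc : 0 < c)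
    (hf : ∀ t ≥ t₀, HasDerivAt f (f' t) t) (hle : ∀ t ≥ t₀, f t ≤ 1)
    (hf' : ∀ t ≥ t₀, c * (1 - f t) ≤ f' t) : Tendsto f atTop (nhds 1) := by
  have hd : ∀ t ≥ t₀, HasDerivAt (fun s => (1 - f s) * Real.exp (c * s))
      (-f' t * Real.exp (c * t) + (1 - f t) * (Real.exp (c * t) * (c * 1))) t := fun t ht =>
    ((hf t ht).const_sub 1).mul (((hasDerivAt_id t).const_mul c).exp)
  have hanti : AntitoneOn (fun s => (1 - f s) * Real.exp (c * s)) (Set.Ici t₀) := by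
    refine antitoneOn_of_hasDerivWithinAt_nonpos (convex_Ici t₀)
      (fun t ht => (hd t ht).continuousAt.continuousWithinAt)
      (fun t ht => (hd t (interior_subset ht)).hasDerivWithinAt) fun t ht => ?_
    nlinarith [Real.exp_pos (c * t), hf' t (interior_subset ht)]
  have hexp : Tendsto (fun t => (1 - f t₀) * Real.exp (c * t₀) * Real.exp (-(c * t))) atTop
      (nhds 0) := by
    simpa using (Real.tendsto_exp_neg_atTop_nhds_zero.comp
      (tendsto_id.const_mul_atTop hc)).const_mul ((1 - f t₀) * Real.exp (c * t₀))
  have hsub : Tendsto (fun t => 1 - f t) atTop (nhds 0) := by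
    refine tendsto_of_tendsto_of_tendsto_of_le_of_le' tendsto_const_nhds hexp ?_ ?_
    · filter_upwards [eventually_ge_atTop t₀] with t ht
      linarith [hle t ht]
    · filter_upwards [eventually_ge_atTop t₀] with t ht
      have h := hanti Set.self_mem_Ici ht ht
      rw [Real.exp_neg, ← div_eq_mul_inv, le_div_iff₀ (Real.exp_pos _)]
      exact h
  simpa using hsub.const_sub 1

/-- Theorem 2, tracking on `S¹`: for `k₂ > 0` and any differentiable
solution `(w₁,w₂) : [0,∞) → S¹` of `ẇ₁ = u_{w,FB} w₂, ẇ₂ = -u_{w,FB} w₁`,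
one has `w₁(t) → 1` and `w₂(t) → 0` as `t → ∞`. -/
theorem S1_tracking (k₂ : ℝ) (hk : 0 < k₂) (w₁ w₂ : ℝ → ℝ)
    (hw : ∀ t ≥ (0 : ℝ), w₁ t ^ 2 + w₂ t ^ 2 = 1)
    (h1 : ∀ t ≥ (0 : ℝ), HasDerivAt w₁ (uwFB k₂ (w₁ t) (w₂ t) * w₂ t) t)
    (h2 : ∀ t ≥ (0 : ℝ), HasDerivAt w₂ (-(uwFB k₂ (w₁ t) (w₂ t)) * w₁ t) t) :
    Tendsto w₁ atTop (nhds 1) ∧ Tendsto w₂ atTop (nhds 0) := by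
  have hderiv := fun t ht => mul_sq_le_uwFB_mul hk (hw t ht)
  have hle : ∀ t ≥ (0 : ℝ), w₁ t ≤ 1 := fun t ht => by nlinarith [hw t ht, sq_nonneg (w₂ t)]
  have hmono : MonotoneOn w₁ (Set.Ici 0) :=
    monotoneOn_of_hasDerivWithinAt_nonneg (convex_Ici 0)
      (fun t ht => (h1 t ht).continuousAt.continuousWithinAt)
      (fun t ht => (h1 t (interior_subset ht)).hasDerivWithinAt)
      fun t ht => le_trans (by positivity) (hderiv t (interior_subset ht))
  -- The solution cannot stay at the point `(-1, 0)`.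
  obtain ⟨t₀, ht₀, hgt⟩ : ∃ t ≥ (0 : ℝ), -1 < w₁ t := by
    by_contra! hcon
    have h_one : ∀ t ≥ (0 : ℝ), w₁ t = -1 := fun t ht =>
      le_antisymm (hcon t ht) (by nlinarith [hw t ht, sq_nonneg (w₂ t)])
    have h_zero : ∀ t ≥ (0 : ℝ), w₂ t = 0 := fun t ht => by
      have h := hw t ht
      rw [h_one t ht] at h
      exact pow_eq_zero_iff two_ne_zero |>.1 (by linarith)
    have hloc : w₂ =ᶠ[nhds 1] fun _ => (0 : ℝ) := by
      filter_upwards [Ici_mem_nhds zero_lt_one] with t ht using h_zero t ht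
    have h := (h2 1 zero_le_one).unique
      ((hasDerivAt_const (1 : ℝ) (0 : ℝ)).congr_of_eventuallyEq hloc)
    rw [h_one 1 zero_le_one, h_zero 1 zero_le_one] at h
    norm_num [uwFB] at h
    exact hk.ne' h
  have hlim₁ : Tendsto w₁ atTop (nhds 1) := by
    refine tendsto_one_of_mul_one_sub_le_deriv (mul_pos hk (by linarith : 0 < 1 + w₁ t₀))
      (fun t ht => h1 t (ht₀.le.trans ht)) (fun t ht => hle t (ht₀.le.trans ht)) fun t ht => ?_
    have ht' : 0 ≤ t := ht₀.le.trans ht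
    refine le_trans ?_ (hderiv t ht')
    have hsq : w₂ t ^ 2 = (1 + w₁ t) * (1 - w₁ t) := by linarith [hw t ht']
    rw [hsq, mul_assoc]
    have := hmono ht₀ ht' ht
    have := hle t ht'
    gcongr
  refine ⟨hlim₁, ?_⟩
  have hsq : Tendsto (fun t => √(1 - w₁ t ^ 2)) atTop (nhds 0) := by
    simpa using ((hlim₁.pow 2).const_sub 1).sqrt
  refine squeeze_zero_norm' ?_ hsq
  filter_upwards [eventually_ge_atTop 0] with t ht
  rw [Real.norm_eq_abs, ← Real.sqrt_sq_eq_abs, ← hw t ht, add_sub_cancel_left]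
end
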